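/- Let X and Y be nonempty finite types, P : X × Y → ℝ a joint distribution, and Δ : X × Y × Y → ℝ a distortion function. If Δ is stably distribution preserving at P, then every kernel Q* minimizing the expected distortion 𝔇(·; P) over all kernels satisfies Q*(x) = P(·|x) for every x with P_X(x) > 0; in particular the minimizer is uniquely determined (at positive-probability inputs) by the true conditional distribution P(·|x). -/

import Mathlib

open Finset

variable {X Y : Type*} [Fintype X] [Fintype Y]

/-- `P : X × Y → ℝ` is a joint probability distribution. -/
def IsJointDist (P : X × Y → ℝ) : Prop :=
  (∀ p, 0 ≤ P p) ∧ ∑ p : X × Y, P p = 1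

/-- `q : Y → ℝ` is a probability mass function. -/
def IsPMF {Z : Type*} [Fintype Z] (q : Z → ℝ) : Prop :=
  (∀ z, 0 ≤ q z) ∧ ∑ z : Z, q z = 1

/-- `q` is a point mass: it assigns probability 1 to a single element. -/
def IsPointMass {Z : Type*} [Fintype Z] [DecidableEq Z] (q : Z → ℝ) : Prop :=
  ∃ z₀, ∀ z, q z = if z = z₀ then 1 else 0

/-- The X-marginal of a joint distribution. -/
def margX (P : X × Y → ℝ) (x : X) : ℝ := ∑ y : Y, P (x, y)

/-- The Y-marginal of a joint distribution. -/
def margY (P : X × Y → ℝ) (y : Y) : ℝ := ∑ x : X, P (x, y)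

/-- The conditional pmf `P(· | x)`. -/
noncomputable def condY (P : X × Y → ℝ) (x : X) (y : Y) : ℝ := P (x, y) / margX P x

/-- `Q : X → Y → ℝ` is a (Markov) kernel: each `Q x` is a pmf on `Y`. -/
def IsKernel (Q : X → Y → ℝ) : Prop := ∀ x, IsPMF (Q x)

/-- The expected distortion of the kernel `Q` under the joint distribution `P`:
`𝔇(Q; P) = Σ_{x,y} P(x,y) · Σ_{y'} Q(x)(y') · Δ(x,y,y')`. -/
def expDist (Δ : X → Y → Y → ℝ) (Q : X → Y → ℝ) (P : X × Y → ℝ) : ℝ :=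
  ∑ x : X, ∑ y : Y, P (x, y) * ∑ y' : Y, Q x y' * Δ x y y'

/-- The output marginal of the kernel `Q` under the input pmf `μ`. -/
def outMarg (Q : X → Y → ℝ) (μ : X → ℝ) (y' : Y) : ℝ := ∑ x : X, μ x * Q x y'

/-- Total variation distance between two pmfs on a finite type. -/
noncomputable def TVdist {Z : Type*} [Fintype Z] (p q : Z → ℝ) : ℝ := (1 / 2) * ∑ z : Z, |p z - q z|

/-- `Q` minimizes the expected distortion `𝔇(·; P)` over all kernels. -/
def MinimizesExpDist (Δ : X → Y → Y → ℝ) (Q : X → Y → ℝ) (P : X × Y → ℝ) : Prop :=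
  IsKernel Q ∧ ∀ Q', IsKernel Q' → expDist Δ Q P ≤ expDist Δ Q' P

/-- `Δ` is distribution preserving at the joint distribution `P`: every kernel
minimizing the expected distortion has output marginal (under `P`'s X-marginal)
equal to `P`'s Y-marginal. -/
def DistPreserving (Δ : X → Y → Y → ℝ) (P : X × Y → ℝ) : Prop :=
  ∀ Q, MinimizesExpDist Δ Q P → outMarg Q (margX P) = margY P

/-- `Δ` is stably distribution preserving at `P`: it is distribution preserving
at every joint distribution in some TV `ε`-ball around `P`. -/
def StablyDistPreserving (Δ : X → Y → Y → ℝ) (P : X × Y → ℝ) : Prop :=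
  ∃ ε > 0, ∀ P' : X × Y → ℝ, IsJointDist P' → TVdist P P' ≤ ε → DistPreserving Δ P'

/-- A minimizer of the expected distortion minimizes the contribution of every single input. -/
lemma MinimizesExpDist.sum_le {Δ : X → Y → Y → ℝ} {Q : X → Y → ℝ} {P : X × Y → ℝ}
    (hQ : MinimizesExpDist Δ Q P) (x : X) {q : Y → ℝ} (hq : IsPMF q) :
    ∑ y, P (x, y) * ∑ y', Q x y' * Δ x y y' ≤ ∑ y, P (x, y) * ∑ y', q y' * Δ x y y' := by
  classical
  by_contra! hlt
  have hker : IsKernel (Function.update Q x q) := by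
    intro x'
    rcases eq_or_ne x' x with rfl | hne
    · simpa using hq
    · simpa [hne] using hQ.1 x'
  refine (hQ.2 _ hker).not_gt (Finset.sum_lt_sum (fun x' _ => ?_) ⟨x, Finset.mem_univ x, ?_⟩)
  · rcases eq_or_ne x' x with rfl | hne
    · simpa using hlt.le
    · simp [hne]
  · simpa using hlt

/-- A minimizer of the expected distortion stays one when the inputs are reweighted. -/
lemma MinimizesExpDist.reweight {Δ : X → Y → Y → ℝ} {Q : X → Y → ℝ} {P : X × Y → ℝ}
    (hQ : MinimizesExpDist Δ Q P) {w : X → ℝ} (hw : ∀ x, 0 ≤ w x) :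
    MinimizesExpDist Δ Q (fun p => w p.1 * P p) := by
  refine ⟨hQ.1, fun Q' hQ' => Finset.sum_le_sum fun x _ => ?_⟩
  simp only [mul_assoc, ← Finset.mul_sum]
  exact mul_le_mul_of_nonneg_left (hQ.sum_le x (hQ' x)) (hw x)

lemma sum_mul_eq_sum_mul_margX (w : X → ℝ) (P : X × Y → ℝ) :
    ∑ p : X × Y, w p.1 * P p = ∑ x, w x * margX P x := by
  simp only [Fintype.sum_prod_type, margX, Finset.mul_sum]

/-- If `Q` preserves the distribution of `P` reweighted by `w`, then the `w`-weighted defects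
of `Q` sum to zero. -/
lemma DistPreserving.sum_mul_sub_eq_zero {Δ : X → Y → Y → ℝ} {Q : X → Y → ℝ} {P : X × Y → ℝ}
    {w : X → ℝ} (h : DistPreserving Δ (fun p => w p.1 * P p)) (hQ : MinimizesExpDist Δ Q P)
    (hw : ∀ x, 0 ≤ w x) (y : Y) :
    ∑ x, w x * (margX P x * Q x y - P (x, y)) = 0 := by
  have hy := congrFun (h Q (hQ.reweight hw)) y
  simp only [outMarg, margX, margY, ← Finset.mul_sum] at hy
  simp only [margX, mul_sub, Finset.sum_sub_distrib, ← mul_assoc]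
  exact sub_eq_zero.mpr hy

/-- Lemma B.2: if `Δ` is stably distribution preserving at the joint
distribution `P`, then every kernel minimizing the expected distortion
`𝔇(·; P)` agrees with the true conditional `P(·|x)` at every
positive-probability input `x`. -/
theorem stably_dist_preserving_minimizer_unique [Nonempty X] [Nonempty Y]
    (P : X × Y → ℝ) (hP : IsJointDist P) (Δ : X → Y → Y → ℝ)
    (hstable : StablyDistPreserving Δ P) :
    ∀ Q : X → Y → ℝ, MinimizesExpDist Δ Q P →
      ∀ x, 0 < margX P x → Q x = condY P x := by
  classical
  obtain ⟨ε, hε, hball⟩ := hstable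
  intro Q hQ x₀ hx₀
  obtain ⟨t, ht, htε, ht1⟩ : ∃ t : ℝ, 0 < t ∧ t ≤ ε ∧ t ≤ 1 :=
    ⟨min ε 1, lt_min hε one_pos, min_le_left _ _, min_le_right _ _⟩
  have hsum : ∑ x, margX P x = 1 := by
    simpa [hP.2] using (sum_mul_eq_sum_mul_margX (fun _ => 1) P).symm
  -- the density of the point mass at `x₀` with respect to the input distribution
  let δ : X → ℝ := fun x => if x = x₀ then (margX P x₀)⁻¹ else 0
  have hδ : ∀ x, 0 ≤ δ x := fun x => by
    dsimp only [δ]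
    split_ifs
    exacts [inv_nonneg.mpr hx₀.le, le_rfl]
  have hδsum : ∑ x, δ x * margX P x = 1 := by simp [δ, hx₀.ne']
  let w : X → ℝ := fun x => 1 - t + t * δ x
  have hw : ∀ x, 0 ≤ w x := fun x =>
    add_nonneg (sub_nonneg.mpr ht1) (mul_nonneg ht.le (hδ x))
  have hjoint : IsJointDist (fun p => w p.1 * P p) := by
    refine ⟨fun p => mul_nonneg (hw p.1) (hP.1 p), ?_⟩
    rw [sum_mul_eq_sum_mul_margX]
    simp only [w, add_mul, Finset.sum_add_distrib, mul_assoc, ← Finset.mul_sum, hsum, hδsum]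
    ring
  have hTV : TVdist P (fun p => w p.1 * P p) ≤ ε := by
    have hle : ∑ p, |P p - w p.1 * P p| ≤ ∑ p : X × Y, (t + t * δ p.1) * P p := by
      refine Finset.sum_le_sum fun p _ => ?_
      have h₁ := mul_nonneg ht.le (hP.1 p)
      have h₂ := mul_nonneg (mul_nonneg ht.le (hδ p.1)) (hP.1 p)
      rw [abs_le]
      constructor <;> simp only [w] <;> linarith
    rw [sum_mul_eq_sum_mul_margX (fun x => t + t * δ x)] at hle
    simp only [add_mul, Finset.sum_add_distrib, mul_assoc, ← Finset.mul_sum, hsum, hδsum] at hle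
    rw [TVdist]
    linarith
  have hself : DistPreserving Δ (fun p => (1 : ℝ) * P p) := by
    simpa using hball P hP (by simpa [TVdist] using hε.le)
  funext y
  have h₁ := hself.sum_mul_sub_eq_zero (w := fun _ => 1) hQ (fun _ => zero_le_one) y
  have h₂ := (hball _ hjoint hTV).sum_mul_sub_eq_zero hQ hw y
  simp only [one_mul] at h₁
  simp only [w, add_mul, Finset.sum_add_distrib, mul_assoc, ← Finset.mul_sum, h₁, mul_zero,
    zero_add] at h₂
  simp only [δ, ite_mul, zero_mul, Finset.sum_ite_eq', Finset.mem_univ, if_true, mul_eq_zero,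
    ht.ne', inv_eq_zero, hx₀.ne', false_or] at h₂
  rw [condY, eq_div_iff hx₀.ne']
  linarith
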